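/- arXiv:2503.05885 — 2 statements merged into one kernel-verified Lean document; each statement's English description precedes it below -/
import Mathlib

section
/- Let d ≥ 1, ν ≥ 0, r > 0, 0 ≤ t₀ < t₁, and let w be a weight. Let v_t : ℤ^d → ℂ^d (t ∈ [t₀,t₁]) be divergence-free and real for every t, with t ↦ ‖w v_t‖_{ℓ¹} integrable on [t₀,t₁], and let a_t : ℤ^d → ℂ solve the Fourier advection–diffusion system with diffusivity ν and velocity v on [t₀,t₁], with a rapidly decreasing locally uniformly in time. Then Σ_{|k|≥r} |a_{t₁}(k)|² − Σ_{|k|≥r} |a_{t₀}(k)|² + 8π²ν ∫_{t₀}^{t₁} Σ_{|k|≥r} |k|² |a_t(k)|² dt ≤ 4πr ∫_{t₀}^{t₁} ‖w v_t‖_{ℓ¹} · (w^{−1} * m_{a_t})(r) dt. -/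
open MeasureTheory ENNReal Real Set
open scoped Classical

noncomputable section

/-- Euclidean norm of a lattice point `k ∈ ℤ^d`. -/
def znorm {d : ℕ} (k : Fin d → ℤ) : ℝ := Real.sqrt (∑ i, ((k i : ℝ)) ^ 2)

/-- Euclidean norm of a vector in `ℂ^d`. -/
def cnorm {d : ℕ} (z : Fin d → ℂ) : ℝ := Real.sqrt (∑ i, ‖z i‖ ^ 2)

/-- Pairing `k · z = Σ_i k_i z_i`. -/
def zdot {d : ℕ} (k : Fin d → ℤ) (z : Fin d → ℂ) : ℂ := ∑ i, (k i : ℂ) * z i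

/-- Divergence-free in Fourier variables: `k · v(k) = 0` for all `k`. -/
def DivFree {d : ℕ} (v : (Fin d → ℤ) → Fin d → ℂ) : Prop := ∀ k, zdot k (v k) = 0

/-- Fourier coefficients of a real vector field: `v(-k) = conj (v k)`. -/
def RealCoeff {d : ℕ} (v : (Fin d → ℤ) → Fin d → ℂ) : Prop :=
  ∀ k i, v (-k) i = starRingEnd ℂ (v k i)

/-- A weight: nondecreasing on `[0,∞)` with values in `[1,∞]`. -/
def IsWeight (w : ℝ → ℝ≥0∞) : Prop :=
  MonotoneOn w (Set.Ici 0) ∧ ∀ s, 0 ≤ s → 1 ≤ w s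

/-- Weighted ℓ¹ norm `‖w v‖_{ℓ¹} = Σ_k w(|k|)|v(k)|`. -/
def wl1 {d : ℕ} (w : ℝ → ℝ≥0∞) (v : (Fin d → ℤ) → Fin d → ℂ) : ℝ≥0∞ :=
  ∑' k, w (znorm k) * ENNReal.ofReal (cnorm (v k))

/-- `(w⁻¹ * m_a)(r) = Σ_k w(||k|-r|)⁻¹ |a(k)|²`. -/
def convMass {d : ℕ} (w : ℝ → ℝ≥0∞) (a : (Fin d → ℤ) → ℂ) (r : ℝ) : ℝ≥0∞ :=
  ∑' k, (w |znorm k - r|)⁻¹ * (‖a k‖₊ : ℝ≥0∞) ^ 2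

/-- `m_a(E) = Σ_{|k| ∈ E} |a(k)|²`. -/
def massOn {d : ℕ} (a : (Fin d → ℤ) → ℂ) (E : Set ℝ) : ℝ≥0∞ :=
  ∑' k, if znorm k ∈ E then (‖a k‖₊ : ℝ≥0∞) ^ 2 else 0

/-- Logarithmic density measure `μ_{a,b}(E)`. -/
def logDensity (a b : ℝ) (E : Set ℝ) : ℝ≥0∞ :=
  (ENNReal.ofReal (Real.log (b / a)))⁻¹ * ∫⁻ r in E ∩ Set.Icc a b, ENNReal.ofReal r⁻¹

/-- The right-hand side of the Fourier advection–diffusion system. -/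
def fourierRHS {d : ℕ} (ν : ℝ) (v : (Fin d → ℤ) → Fin d → ℂ) (a : (Fin d → ℤ) → ℂ)
    (k : Fin d → ℤ) : ℂ :=
  Complex.ofReal (-(4 * π ^ 2 * ν * znorm k ^ 2)) * a k
    - 2 * Complex.ofReal π * Complex.I * ∑' j, zdot k (v (k - j)) * a j

section FourierFlux

variable {d : ℕ}

lemma znorm_eq_norm (k : Fin d → ℤ) :
    znorm k = ‖WithLp.toLp 2 (fun i => (k i : ℝ))‖ := by
  simp [znorm, EuclideanSpace.norm_eq]

lemma znorm_nonneg (k : Fin d → ℤ) : 0 ≤ znorm k := Real.sqrt_nonneg _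

lemma cnorm_nonneg (z : Fin d → ℂ) : 0 ≤ cnorm z := Real.sqrt_nonneg _

lemma abs_znorm_sub_znorm_le (k j : Fin d → ℤ) : |znorm k - znorm j| ≤ znorm (k - j) := by
  have h : (WithLp.toLp 2 fun i => ((k - j) i : ℝ)) =
      WithLp.toLp 2 (fun i => (k i : ℝ)) - WithLp.toLp 2 (fun i => (j i : ℝ)) := by
    ext i; simp
  rw [znorm_eq_norm, znorm_eq_norm, znorm_eq_norm, h]
  exact abs_norm_sub_norm_le _ _

lemma abs_apply_le_znorm (k : Fin d → ℤ) (i : Fin d) : |(k i : ℝ)| ≤ znorm k := by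
  rw [znorm_eq_norm]
  exact PiLp.norm_apply_le (WithLp.toLp 2 (fun i => (k i : ℝ))) i

lemma norm_zdot_le (k : Fin d → ℤ) (z : Fin d → ℂ) : ‖zdot k z‖ ≤ znorm k * cnorm z := by
  refine (norm_sum_le _ _).trans ?_
  refine le_trans (le_of_eq ?_) (Real.sum_mul_le_sqrt_mul_sqrt Finset.univ
    (fun i => |(k i : ℝ)|) (fun i => ‖z i‖)) |>.trans (le_of_eq ?_)
  · simp
  · simp [znorm, cnorm]

lemma zdot_sub_left (k j : Fin d → ℤ) (z : Fin d → ℂ) :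
    zdot (k - j) z = zdot k z - zdot j z := by
  simp [zdot, sub_mul]

/-- Incompressibility lets the two frequencies of an interaction be exchanged. -/
lemma DivFree.zdot_eq {v : (Fin d → ℤ) → Fin d → ℂ} (hv : DivFree v) (k j : Fin d → ℤ) :
    zdot k (v (k - j)) = zdot j (v (k - j)) := by
  rw [← sub_eq_zero, ← zdot_sub_left]
  exact hv _

lemma RealCoeff.conj_zdot {v : (Fin d → ℤ) → Fin d → ℂ} (hv : RealCoeff v)
    (k l : Fin d → ℤ) : starRingEnd ℂ (zdot k (v l)) = zdot k (v (-l)) := by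
  simp [zdot, hv l]

lemma finite_znorm_le (R : ℝ) : {k : Fin d → ℤ | znorm k ≤ R}.Finite := by
  refine (Set.finite_Icc (fun _ : Fin d => -⌈R⌉) (fun _ => ⌈R⌉)).subset fun k hk => ?_
  have h : ∀ i, |k i| ≤ ⌈R⌉ := fun i => by
    have := ((abs_apply_le_znorm k i).trans hk).trans (Int.le_ceil R)
    exact_mod_cast this
  exact ⟨fun i => (abs_le.1 (h i)).1, fun i => (abs_le.1 (h i)).2⟩

/-- The lattice points in the closed shell between the radii `r` and `R`. -/
def latticeShell (d : ℕ) (r R : ℝ) : Finset (Fin d → ℤ) :=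
  ((finite_znorm_le R).subset
    (fun _ hk => hk.2 : {k : Fin d → ℤ | r ≤ znorm k ∧ znorm k ≤ R} ⊆ _)).toFinset

lemma mem_latticeShell {r R : ℝ} {k : Fin d → ℤ} :
    k ∈ latticeShell d r R ↔ r ≤ znorm k ∧ znorm k ≤ R := by
  simp [latticeShell]

/-- The triadic interaction through which frequency `j` feeds frequency `k`. -/
def triad (v : (Fin d → ℤ) → Fin d → ℂ) (a : (Fin d → ℤ) → ℂ) (k j : Fin d → ℤ) : ℂ :=
  starRingEnd ℂ (a k) * (zdot k (v (k - j)) * a j)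

lemma conj_triad {v : (Fin d → ℤ) → Fin d → ℂ} (hdiv : DivFree v) (hreal : RealCoeff v)
    (a : (Fin d → ℤ) → ℂ) (k j : Fin d → ℤ) :
    starRingEnd ℂ (triad v a k j) = triad v a j k := by
  simp only [triad, map_mul, Complex.conj_conj, hreal.conj_zdot, neg_sub, hdiv.zdot_eq j k]
  ring

lemma im_sum_triad_eq_zero {v : (Fin d → ℤ) → Fin d → ℂ} (hdiv : DivFree v)
    (hreal : RealCoeff v) (a : (Fin d → ℤ) → ℂ) (F : Finset (Fin d → ℤ)) :
    (∑ k ∈ F, ∑ j ∈ F, triad v a k j).im = 0 := by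
  rw [← Complex.conj_eq_iff_im]
  simp only [map_sum, conj_triad hdiv hreal]
  exact Finset.sum_comm

lemma norm_triad_le {v : (Fin d → ℤ) → Fin d → ℂ} (hdiv : DivFree v)
    (a : (Fin d → ℤ) → ℂ) (k j : Fin d → ℤ) :
    ‖triad v a k j‖ ≤ cnorm (v (k - j)) * (znorm j * (‖a k‖ * ‖a j‖)) := by
  have h := norm_zdot_le j (v (k - j))
  rw [triad, norm_mul, norm_mul, RCLike.norm_conj, hdiv.zdot_eq]
  calc ‖a k‖ * (‖zdot j (v (k - j))‖ * ‖a j‖)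
      ≤ ‖a k‖ * ((znorm j * cnorm (v (k - j))) * ‖a j‖) := by gcongr
    _ = _ := by ring

lemma summable_cnorm {w : ℝ → ℝ≥0∞} (hw : IsWeight w) {v : (Fin d → ℤ) → Fin d → ℂ}
    (hv : wl1 w v ≠ ⊤) : Summable fun k => cnorm (v k) := by
  have h : ∑' k, ENNReal.ofReal (cnorm (v k)) ≠ ⊤ :=
    ne_top_of_le_ne_top hv <| ENNReal.tsum_le_tsum fun k =>
      le_mul_of_one_le_left' (hw.2 _ (znorm_nonneg k))
  exact (ENNReal.summable_toReal h).congr fun k => ENNReal.toReal_ofReal (cnorm_nonneg _)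

lemma tsum_tsum_sub_mul_add {G : Type*} [AddCommGroup G] (f h : G → ℝ≥0∞) :
    ∑' k, ∑' j, f (k - j) * (h k + h j) = 2 * ((∑' k, f k) * ∑' k, h k) := by
  have h1 : ∑' k, ∑' j, f (k - j) * h k = (∑' k, f k) * ∑' k, h k := by
    rw [← ENNReal.tsum_mul_left]
    refine tsum_congr fun k => ?_
    rw [ENNReal.tsum_mul_right]
    congr 1
    exact (Equiv.subLeft k).tsum_eq f
  have h2 : ∑' k, ∑' j, f (k - j) * h j = (∑' k, f k) * ∑' k, h k := by
    rw [ENNReal.tsum_comm, ← ENNReal.tsum_mul_left]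
    refine tsum_congr fun j => ?_
    rw [ENNReal.tsum_mul_right]
    congr 1
    exact (Equiv.subRight j).tsum_eq f
  simp only [mul_add, ENNReal.tsum_add, h1, h2, two_mul]

lemma IsWeight.le_mul_inv {w : ℝ → ℝ≥0∞} (hw : IsWeight w) {s u : ℝ} (hu : 0 ≤ u)
    (hus : u ≤ s) {b : ℝ≥0∞} (hb : w s * b ≠ ⊤) : b ≤ w s * b * (w u)⁻¹ := by
  have hle : w u ≤ w s := hw.1 hu (hu.trans hus) hus
  rcases eq_or_ne b 0 with rfl | hb0
  · simp
  have hs : w s ≠ ⊤ := fun h => hb (by simp [h, hb0])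
  have hu0 : w u ≠ 0 := (zero_lt_one.trans_le (hw.2 u hu)).ne'
  calc b = w u * b * (w u)⁻¹ := by
        rw [mul_right_comm, ENNReal.mul_inv_cancel hu0 (ne_top_of_le_ne_top hs hle), one_mul]
    _ ≤ _ := by gcongr

/-- The density of the mass that can interact across the shell between radii `r` and `R`. -/
def shellDensity (w : ℝ → ℝ≥0∞) (a : (Fin d → ℤ) → ℂ) (r R : ℝ) (k : Fin d → ℤ) : ℝ≥0∞ :=
  ENNReal.ofReal r * ((w |znorm k - r|)⁻¹ * (‖a k‖₊ : ℝ≥0∞) ^ 2)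
    + ENNReal.ofReal R⁻¹ * (ENNReal.ofReal ((1 + znorm k) ^ 4) * (‖a k‖₊ : ℝ≥0∞) ^ 2)

lemma tsum_shellDensity (w : ℝ → ℝ≥0∞) (a : (Fin d → ℤ) → ℂ) (r R : ℝ) :
    ∑' k, shellDensity w a r R k = ENNReal.ofReal r * convMass w a r
      + ENNReal.ofReal R⁻¹ *
        ∑' k, ENNReal.ofReal ((1 + znorm k) ^ 4) * (‖a k‖₊ : ℝ≥0∞) ^ 2 := by
  simp only [shellDensity, convMass, ENNReal.tsum_add, ENNReal.tsum_mul_left]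

lemma ofReal_norm_sq (z : ℂ) : ENNReal.ofReal (‖z‖ ^ 2) = (‖z‖₊ : ℝ≥0∞) ^ 2 := by
  rw [ENNReal.ofReal_pow (norm_nonneg z), ofReal_norm]
  rfl

lemma two_mul_enorm_triad_le {w : ℝ → ℝ≥0∞} (hw : IsWeight w)
    {v : (Fin d → ℤ) → Fin d → ℂ} (hdiv : DivFree v) (hv : wl1 w v ≠ ⊤)
    (a : (Fin d → ℤ) → ℂ) {r R : ℝ} (hr : 0 < r) (hR : 0 < R) {k j : Fin d → ℤ}
    (hk : k ∈ latticeShell d r R) (hj : j ∉ latticeShell d r R) :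
    2 * ‖triad v a k j‖ₑ ≤ w (znorm (k - j)) * ENNReal.ofReal (cnorm (v (k - j))) *
      (shellDensity w a r R k + shellDensity w a r R j) := by
  rw [mem_latticeShell] at hk hj
  have hT := norm_triad_le hdiv a k j
  have hc := cnorm_nonneg (v (k - j))
  have hzj := znorm_nonneg j
  have hzk := znorm_nonneg k
  set c := cnorm (v (k - j))
  set W := w (znorm (k - j)) * ENNReal.ofReal c with hW
  have hWtop : W ≠ ⊤ := ENNReal.ne_top_of_tsum_ne_top hv (k - j)
  have h2 : 2 * ‖triad v a k j‖ₑ = ENNReal.ofReal (2 * ‖triad v a k j‖) := by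
    rw [ENNReal.ofReal_mul (by norm_num), ofReal_norm]; simp
  have hxy := two_mul_le_add_sq ‖a k‖ ‖a j‖
  have htri := abs_le.1 (abs_znorm_sub_znorm_le k j)
  rw [h2]
  rcases lt_or_ge (znorm j) r with hjr | hjr
  · have hreal : 2 * ‖triad v a k j‖ ≤ r * (c * (‖a k‖ ^ 2 + ‖a j‖ ^ 2)) := by
      calc 2 * ‖triad v a k j‖ ≤ 2 * (c * (znorm j * (‖a k‖ * ‖a j‖))) := by gcongr
        _ ≤ 2 * (c * (r * (‖a k‖ * ‖a j‖))) := by gcongr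
        _ = r * (c * (2 * ‖a k‖ * ‖a j‖)) := by ring
        _ ≤ _ := by gcongr
    have hbk : ENNReal.ofReal c ≤ W * (w |znorm k - r|)⁻¹ := by
      refine hw.le_mul_inv (abs_nonneg _) ?_ hWtop
      rw [abs_of_nonneg (by linarith)]; linarith
    have hbj : ENNReal.ofReal c ≤ W * (w |znorm j - r|)⁻¹ := by
      refine hw.le_mul_inv (abs_nonneg _) ?_ hWtop
      rw [abs_of_nonpos (by linarith)]; linarith
    calc ENNReal.ofReal (2 * ‖triad v a k j‖)
        ≤ ENNReal.ofReal (r * (c * (‖a k‖ ^ 2 + ‖a j‖ ^ 2))) := ENNReal.ofReal_le_ofReal hreal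
      _ = ENNReal.ofReal r * (ENNReal.ofReal c * (‖a k‖₊ : ℝ≥0∞) ^ 2
            + ENNReal.ofReal c * (‖a j‖₊ : ℝ≥0∞) ^ 2) := by
          rw [ENNReal.ofReal_mul hr.le, ENNReal.ofReal_mul hc,
            ENNReal.ofReal_add (sq_nonneg _) (sq_nonneg _), ofReal_norm_sq, ofReal_norm_sq,
            mul_add (ENNReal.ofReal c)]
      _ ≤ ENNReal.ofReal r * (W * (w |znorm k - r|)⁻¹ * (‖a k‖₊ : ℝ≥0∞) ^ 2
            + W * (w |znorm j - r|)⁻¹ * (‖a j‖₊ : ℝ≥0∞) ^ 2) := by gcongr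
      _ = W * (ENNReal.ofReal r * ((w |znorm k - r|)⁻¹ * (‖a k‖₊ : ℝ≥0∞) ^ 2)
            + ENNReal.ofReal r * ((w |znorm j - r|)⁻¹ * (‖a j‖₊ : ℝ≥0∞) ^ 2)) := by ring
      _ ≤ _ := by
          gcongr <;> exact le_self_add
  · have hjR : R < znorm j := not_le.1 fun h => hj ⟨hjr, h⟩
    have hcW : ENNReal.ofReal c ≤ W := le_mul_of_one_le_left' (hw.2 _ (znorm_nonneg _))
    have hzsq : znorm j ≤ R⁻¹ * znorm j ^ 2 := by
      rw [inv_mul_eq_div, le_div_iff₀ hR]; nlinarith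
    have hk4 : ‖a k‖ ^ 2 ≤ (1 + znorm k) ^ 4 * ‖a k‖ ^ 2 :=
      le_mul_of_one_le_left (sq_nonneg _) (one_le_pow₀ (by linarith))
    have hj4 : (znorm j ^ 2 * ‖a j‖) ^ 2 ≤ (1 + znorm j) ^ 4 * ‖a j‖ ^ 2 := by
      have : znorm j ^ 4 ≤ (1 + znorm j) ^ 4 := by gcongr; linarith
      calc (znorm j ^ 2 * ‖a j‖) ^ 2 = znorm j ^ 4 * ‖a j‖ ^ 2 := by ring
        _ ≤ _ := by gcongr
    have hxy' := two_mul_le_add_sq ‖a k‖ (znorm j ^ 2 * ‖a j‖)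
    have hreal : 2 * ‖triad v a k j‖ ≤
        c * (R⁻¹ * ((1 + znorm k) ^ 4 * ‖a k‖ ^ 2) + R⁻¹ * ((1 + znorm j) ^ 4 * ‖a j‖ ^ 2)) := by
      calc 2 * ‖triad v a k j‖ ≤ 2 * (c * (znorm j * (‖a k‖ * ‖a j‖))) := by gcongr
        _ ≤ 2 * (c * ((R⁻¹ * znorm j ^ 2) * (‖a k‖ * ‖a j‖))) := by gcongr
        _ = c * (R⁻¹ * (2 * ‖a k‖ * (znorm j ^ 2 * ‖a j‖))) := by ring
        _ ≤ c * (R⁻¹ * ((1 + znorm k) ^ 4 * ‖a k‖ ^ 2 + (1 + znorm j) ^ 4 * ‖a j‖ ^ 2)) := by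
            gcongr; linarith
        _ = _ := by ring
    calc ENNReal.ofReal (2 * ‖triad v a k j‖) ≤ _ := ENNReal.ofReal_le_ofReal hreal
      _ = ENNReal.ofReal c *
          (ENNReal.ofReal R⁻¹ * (ENNReal.ofReal ((1 + znorm k) ^ 4) * (‖a k‖₊ : ℝ≥0∞) ^ 2)
          + ENNReal.ofReal R⁻¹ *
            (ENNReal.ofReal ((1 + znorm j) ^ 4) * (‖a j‖₊ : ℝ≥0∞) ^ 2)) := by
          rw [ENNReal.ofReal_mul hc, ENNReal.ofReal_add (by positivity) (by positivity),
            ENNReal.ofReal_mul (by positivity), ENNReal.ofReal_mul (by positivity),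
            ENNReal.ofReal_mul (by positivity), ENNReal.ofReal_mul (by positivity),
            ofReal_norm_sq, ofReal_norm_sq]
      _ ≤ _ := by
          gcongr <;> exact le_add_self

/-- At a fixed time, the transfer of mass into a shell is controlled by the interactions
across its boundary. -/
lemma ofReal_sum_transfer_le {w : ℝ → ℝ≥0∞} (hw : IsWeight w)
    {v : (Fin d → ℤ) → Fin d → ℂ} (hdiv : DivFree v) (hreal : RealCoeff v)
    (hv : wl1 w v ≠ ⊤) {a : (Fin d → ℤ) → ℂ} {M : ℝ}
    (ha : ∑' k, ENNReal.ofReal ((1 + znorm k) ^ 4) * (‖a k‖₊ : ℝ≥0∞) ^ 2 ≤ ENNReal.ofReal M)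
    {r R : ℝ} (hr : 0 < r) (hR : 0 < R) :
    ENNReal.ofReal (∑ k ∈ latticeShell d r R,
        (starRingEnd ℂ (a k) * ∑' j, zdot k (v (k - j)) * a j).im)
      ≤ wl1 w v *
        (ENNReal.ofReal r * convMass w a r + ENNReal.ofReal R⁻¹ * ENNReal.ofReal M) := by
  set F := latticeShell d r R
  obtain ⟨C, hC⟩ : ∃ C : ℝ, ∀ k, ‖a k‖ ≤ C := by
    refine ⟨Real.sqrt (max M 0), fun k => Real.le_sqrt_of_sq_le ?_⟩
    have h1 : (‖a k‖₊ : ℝ≥0∞) ^ 2 ≤ ENNReal.ofReal M := by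
      refine le_trans ?_ ((ENNReal.le_tsum k).trans ha)
      refine le_mul_of_one_le_left' (ENNReal.one_le_ofReal.2 (one_le_pow₀ ?_))
      linarith [znorm_nonneg k]
    rw [← ofReal_norm_sq] at h1
    exact le_max_iff.2 (ENNReal.ofReal_le_ofReal_iff'.1 h1)
  have hsum : ∀ k, Summable (triad v a k) := fun k => by
    have hs : Summable fun j => cnorm (v (k - j)) :=
      (summable_cnorm hw hv).comp_injective (sub_right_injective (b := k))
    refine Summable.mul_left _ (Summable.of_norm_bounded (hs.mul_left (znorm k * C)) fun j => ?_)
    rw [norm_mul]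
    calc ‖zdot k (v (k - j))‖ * ‖a j‖ ≤ (znorm k * cnorm (v (k - j))) * C := by
          gcongr
          · exact mul_nonneg (znorm_nonneg _) (cnorm_nonneg _)
          · exact norm_zdot_le _ _
          · exact hC j
      _ = _ := by ring
  have hsplit : ∑ k ∈ F, (starRingEnd ℂ (a k) * ∑' j, zdot k (v (k - j)) * a j).im
      = (∑ k ∈ F, ∑' j : ((F : Set (Fin d → ℤ))ᶜ : Set _), triad v a k j).im := by
    rw [← Complex.im_sum, ← zero_add (Complex.im (∑ k ∈ F, ∑' j : _, _)),
      ← im_sum_triad_eq_zero hdiv hreal a F, ← Complex.add_im, ← Finset.sum_add_distrib]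
    congr 1
    refine Finset.sum_congr rfl fun k _ => ?_
    rw [(hsum k).sum_add_tsum_compl, ← tsum_mul_left]
    rfl
  rw [hsplit]
  refine (ENNReal.mul_le_mul_iff_right two_ne_zero ENNReal.ofNat_ne_top).1 ?_
  calc 2 * ENNReal.ofReal
        (∑ k ∈ F, ∑' j : ((F : Set (Fin d → ℤ))ᶜ : Set _), triad v a k j).im
      ≤ 2 * ∑ k ∈ F, ∑' j : ((F : Set (Fin d → ℤ))ᶜ : Set _), ‖triad v a k j‖ₑ := by
        gcongr
        refine (ENNReal.ofReal_le_ofReal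
          ((le_abs_self _).trans (Complex.abs_im_le_norm _))).trans ?_
        rw [ofReal_norm]
        refine (enorm_sum_le _ _).trans (Finset.sum_le_sum fun k _ => ?_)
        exact enorm_tsum_le_tsum_enorm
    _ = ∑ k ∈ F, ∑' j : ((F : Set (Fin d → ℤ))ᶜ : Set _), 2 * ‖triad v a k j‖ₑ := by
        simp only [Finset.mul_sum, ENNReal.tsum_mul_left]
    _ ≤ ∑ k ∈ F, ∑' j : ((F : Set (Fin d → ℤ))ᶜ : Set _),
          w (znorm (k - j.1)) * ENNReal.ofReal (cnorm (v (k - j.1))) *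
            (shellDensity w a r R k + shellDensity w a r R j.1) := by
        refine Finset.sum_le_sum fun k hk => ENNReal.tsum_le_tsum fun j => ?_
        exact two_mul_enorm_triad_le hw hdiv hv a hr hR hk (fun h => j.2 h)
    _ ≤ ∑ k ∈ F, ∑' j, w (znorm (k - j)) * ENNReal.ofReal (cnorm (v (k - j))) *
            (shellDensity w a r R k + shellDensity w a r R j) := by
        refine Finset.sum_le_sum fun k _ => ?_
        exact ENNReal.tsum_comp_le_tsum_of_injective Subtype.val_injective
          (fun j => w (znorm (k - j)) * ENNReal.ofReal (cnorm (v (k - j))) *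
            (shellDensity w a r R k + shellDensity w a r R j))
    _ ≤ ∑' k, ∑' j, w (znorm (k - j)) * ENNReal.ofReal (cnorm (v (k - j))) *
            (shellDensity w a r R k + shellDensity w a r R j) := ENNReal.sum_le_tsum _
    _ = 2 * (wl1 w v * ∑' k, shellDensity w a r R k) :=
        tsum_tsum_sub_mul_add (fun l => w (znorm l) * ENNReal.ofReal (cnorm (v l))) _
    _ ≤ _ := by
        rw [tsum_shellDensity]
        gcongr

lemma ofReal_integral_le_lintegral_ofReal {α : Type*} [MeasurableSpace α] {μ : Measure α}
    {f : α → ℝ} (hf : Integrable f μ) :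
    ENNReal.ofReal (∫ x, f x ∂μ) ≤ ∫⁻ x, ENNReal.ofReal (f x) ∂μ := by
  have h : ∫ x, f x ∂μ ≤ ∫ x, max (f x) 0 ∂μ :=
    integral_mono hf hf.pos_part fun x => le_max_left _ _
  refine (ENNReal.ofReal_le_ofReal h).trans ?_
  rw [ofReal_integral_eq_lintegral_ofReal hf.pos_part (.of_forall fun x => le_max_right _ _)]
  exact lintegral_mono fun x => by simp

lemma two_mul_inner_fourierRHS (ν : ℝ) (v : (Fin d → ℤ) → Fin d → ℂ) (a : (Fin d → ℤ) → ℂ)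
    (k : Fin d → ℤ) :
    2 * inner ℝ (a k) (fourierRHS ν v a k) =
      4 * π * (starRingEnd ℂ (a k) * ∑' j, zdot k (v (k - j)) * a j).im
        - 8 * π ^ 2 * ν * (znorm k ^ 2 * ‖a k‖ ^ 2) := by
  rw [Complex.inner, fourierRHS, ← Complex.normSq_eq_norm_sq, Complex.normSq_apply]
  generalize hc : -(4 * π ^ 2 * ν * znorm k ^ 2) = c
  simp
  rw [← hc]
  ring

/-- The energy balance of finitely many Fourier modes. -/
lemma shell_energy_le {ν t₀ t₁ : ℝ} (hν : 0 ≤ ν) (ht : t₀ ≤ t₁)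
    {v : ℝ → (Fin d → ℤ) → Fin d → ℂ} {a : ℝ → (Fin d → ℤ) → ℂ}
    (hODE : ∀ (k : Fin d → ℤ), ∀ t ∈ Set.Icc t₀ t₁,
      HasDerivWithinAt (fun s => a s k) (fourierRHS ν (v t) (a t) k) (Set.Icc t₀ t₁) t)
    (hC1 : ∀ k : Fin d → ℤ, ContinuousOn (fun t => fourierRHS ν (v t) (a t) k) (Set.Icc t₀ t₁))
    (F : Finset (Fin d → ℤ)) :
    ∑ k ∈ F, ((‖a t₁ k‖₊ : ℝ≥0∞) ^ 2 + ENNReal.ofReal (8 * π ^ 2 * ν) *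
        ∫⁻ t in Set.Ioc t₀ t₁, ENNReal.ofReal (znorm k ^ 2) * (‖a t k‖₊ : ℝ≥0∞) ^ 2)
      ≤ ∑ k ∈ F, (‖a t₀ k‖₊ : ℝ≥0∞) ^ 2 + ∫⁻ t in Set.Ioc t₀ t₁,
        ENNReal.ofReal (4 * π * ∑ k ∈ F,
          (starRingEnd ℂ (a t k) * ∑' j, zdot k (v t (k - j)) * a t j).im) := by
  have hcont : ∀ k, ContinuousOn (fun t => a t k) (Set.Icc t₀ t₁) :=
    fun k t h => (hODE k t h).continuousWithinAt
  have hint : ∀ {f : ℝ → ℝ}, ContinuousOn f (Set.Icc t₀ t₁) → IntegrableOn f (Set.Ioc t₀ t₁) :=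
    fun hf => hf.integrableOn_Icc.mono_set Set.Ioc_subset_Icc_self
  set g : ℝ → ℝ := fun t => ∑ k ∈ F, 2 * inner ℝ (a t k) (fourierRHS ν (v t) (a t) k) with hg
  set D : (Fin d → ℤ) → ℝ → ℝ := fun k t => 8 * π ^ 2 * ν * (znorm k ^ 2 * ‖a t k‖ ^ 2) with hD
  have hgc : ContinuousOn g (Set.Icc t₀ t₁) :=
    continuousOn_finsetSum _ fun k _ => ((hcont k).inner (hC1 k)).const_mul 2
  have hDc : ∀ k, ContinuousOn (D k) (Set.Icc t₀ t₁) := fun k =>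
    (((hcont k).norm.pow 2).const_mul _).const_mul _
  have hD0 : ∀ k t, 0 ≤ D k t := fun k t => by positivity
  have hFTC : ∫ t in Set.Ioc t₀ t₁, g t = ∑ k ∈ F, ‖a t₁ k‖ ^ 2 - ∑ k ∈ F, ‖a t₀ k‖ ^ 2 := by
    rw [← intervalIntegral.integral_of_le ht]
    refine intervalIntegral.integral_eq_sub_of_hasDerivAt_of_le ht
      (f := fun t => ∑ k ∈ F, ‖a t k‖ ^ 2)
      (continuousOn_finsetSum _ fun k _ => (hcont k).norm.pow 2) (fun t htI => ?_)
      ((hgc.mono (by rw [Set.uIcc_of_le ht])).intervalIntegrable)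
    have hd : HasDerivWithinAt (fun t => ∑ k ∈ F, ‖a t k‖ ^ 2) (g t) (Set.Icc t₀ t₁) t :=
      HasDerivWithinAt.fun_sum fun k _ => (hODE k t (Set.Ioo_subset_Icc_self htI)).norm_sq
    exact hd.hasDerivAt (Icc_mem_nhds htI.1 htI.2)
  have hsplit : ∀ t, 4 * π * ∑ k ∈ F,
      (starRingEnd ℂ (a t k) * ∑' j, zdot k (v t (k - j)) * a t j).im
      = g t + ∑ k ∈ F, D k t := fun t => by
    simp only [hg, hD, two_mul_inner_fourierRHS, ← Finset.sum_add_distrib, Finset.mul_sum,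
      sub_add_cancel]
  have hsumD : Integrable (fun t => ∑ k ∈ F, D k t) (volume.restrict (Set.Ioc t₀ t₁)) :=
    integrable_finsetSum _ fun k _ => hint (hDc k)
  have hDint : ∀ k, ENNReal.ofReal (8 * π ^ 2 * ν) *
      ∫⁻ t in Set.Ioc t₀ t₁, ENNReal.ofReal (znorm k ^ 2) * (‖a t k‖₊ : ℝ≥0∞) ^ 2
      = ENNReal.ofReal (∫ t in Set.Ioc t₀ t₁, D k t) := fun k => by
    rw [ofReal_integral_eq_lintegral_ofReal (hint (hDc k)) (.of_forall (hD0 k)),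
      ← lintegral_const_mul' _ _ ofReal_ne_top]
    refine lintegral_congr fun t => ?_
    rw [← ofReal_norm_sq, ← ENNReal.ofReal_mul (by positivity), ← ENNReal.ofReal_mul (by positivity)]
  simp only [hsplit, hDint]
  simp only [← ofReal_norm_sq]
  have hint0 : ∀ k, 0 ≤ ∫ t in Set.Ioc t₀ t₁, D k t := fun k => integral_nonneg (hD0 k)
  calc ∑ k ∈ F, (ENNReal.ofReal (‖a t₁ k‖ ^ 2) + ENNReal.ofReal (∫ t in Set.Ioc t₀ t₁, D k t))
      = ENNReal.ofReal (∑ k ∈ F, (‖a t₁ k‖ ^ 2 + ∫ t in Set.Ioc t₀ t₁, D k t)) := by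
        rw [ENNReal.ofReal_sum_of_nonneg fun k _ => add_nonneg (sq_nonneg _) (hint0 k)]
        exact Finset.sum_congr rfl fun k _ => (ENNReal.ofReal_add (sq_nonneg _) (hint0 k)).symm
    _ = ENNReal.ofReal (∑ k ∈ F, ‖a t₀ k‖ ^ 2
          + ∫ t in Set.Ioc t₀ t₁, (g t + ∑ k ∈ F, D k t)) := by
        rw [integral_add (hint hgc) hsumD, integral_finsetSum _ fun k _ => hint (hDc k), hFTC,
          Finset.sum_add_distrib]
        congr 1
        ring
    _ ≤ ENNReal.ofReal (∑ k ∈ F, ‖a t₀ k‖ ^ 2)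
          + ENNReal.ofReal (∫ t in Set.Ioc t₀ t₁, (g t + ∑ k ∈ F, D k t)) := ofReal_add_le
    _ ≤ _ := by
        rw [ENNReal.ofReal_sum_of_nonneg fun k _ => sq_nonneg _]
        gcongr
        exact ofReal_integral_le_lintegral_ofReal ((hint hgc).add hsumD)

end FourierFlux

/-- the flux inequality (Theorem 1.4 of the paper) in Fourier variables:
the high-frequency mass at time `t₁`, plus the accumulated high-frequency dissipation,
is bounded by the high-frequency mass at time `t₀` plus the time-integrated flux
`4πr ‖w v_t‖_{ℓ¹} (w⁻¹ * m_{a_t})(r)`. -/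
theorem flux_inequality {d : ℕ} (hd : 1 ≤ d) (ν r t₀ t₁ : ℝ)
    (hν : 0 ≤ ν) (hr : 0 < r) (ht₀ : 0 ≤ t₀) (ht : t₀ < t₁)
    (w : ℝ → ℝ≥0∞) (hw : IsWeight w)
    (v : ℝ → (Fin d → ℤ) → Fin d → ℂ)
    (hdiv : ∀ t ∈ Set.Icc t₀ t₁, DivFree (v t))
    (hreal : ∀ t ∈ Set.Icc t₀ t₁, RealCoeff (v t))
    (hvmeas : Measurable fun t => wl1 w (v t))
    (hvint : ∫⁻ t in Set.Icc t₀ t₁, wl1 w (v t) ≠ ⊤)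
    (a : ℝ → (Fin d → ℤ) → ℂ)
    (hODE : ∀ (k : Fin d → ℤ), ∀ t ∈ Set.Icc t₀ t₁,
      HasDerivWithinAt (fun s => a s k) (fourierRHS ν (v t) (a t) k) (Set.Icc t₀ t₁) t)
    (hC1 : ∀ k : Fin d → ℤ, ContinuousOn (fun t => fourierRHS ν (v t) (a t) k) (Set.Icc t₀ t₁))
    (hrapid : ∀ N : ℕ, ∀ T > (0 : ℝ), ∃ M : ℝ, ∀ t ∈ Set.Icc (0 : ℝ) T,
      ∑' k : Fin d → ℤ, ENNReal.ofReal ((1 + znorm k) ^ N) * (‖a t k‖₊ : ℝ≥0∞) ^ 2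
        ≤ ENNReal.ofReal M) :
    massOn (a t₁) (Set.Ici r)
      + ENNReal.ofReal (8 * π ^ 2 * ν) *
        (∫⁻ t in Set.Ioc t₀ t₁, ∑' k : Fin d → ℤ,
          if r ≤ znorm k then ENNReal.ofReal (znorm k ^ 2) * (‖a t k‖₊ : ℝ≥0∞) ^ 2 else 0)
      ≤ massOn (a t₀) (Set.Ici r)
        + ENNReal.ofReal (4 * π * r) *
          ∫⁻ t in Set.Ioc t₀ t₁, wl1 w (v t) * convMass w (a t) r := by
  obtain ⟨M, hM⟩ := hrapid 4 t₁ (ht₀.trans_lt ht)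
  have hIoc : Set.Ioc t₀ t₁ ⊆ Set.Icc t₀ t₁ := Set.Ioc_subset_Icc_self
  have hcont : ∀ k, ContinuousOn (fun t => a t k) (Set.Icc t₀ t₁) :=
    fun k t h => (hODE k t h).continuousWithinAt
  have hV : ∫⁻ t in Set.Ioc t₀ t₁, wl1 w (v t) ≠ ⊤ :=
    ne_top_of_le_ne_top hvint (lintegral_mono_set hIoc)
  have hfin : ∀ᵐ t ∂volume.restrict (Set.Ioc t₀ t₁), wl1 w (v t) ≠ ⊤ :=
    (ae_lt_top hvmeas hV).mono fun _ h => h.ne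
  set B := massOn (a t₀) (Set.Ici r) + ENNReal.ofReal (4 * π * r) *
    ∫⁻ t in Set.Ioc t₀ t₁, wl1 w (v t) * convMass w (a t) r with hB
  have hshell : ∀ R : ℝ, 0 < R →
      ∑ k ∈ latticeShell d r R, ((‖a t₁ k‖₊ : ℝ≥0∞) ^ 2 + ENNReal.ofReal (8 * π ^ 2 * ν) *
        ∫⁻ t in Set.Ioc t₀ t₁, ENNReal.ofReal (znorm k ^ 2) * (‖a t k‖₊ : ℝ≥0∞) ^ 2)
      ≤ B + ENNReal.ofReal R⁻¹ * (ENNReal.ofReal (4 * π) * ENNReal.ofReal M *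
        ∫⁻ t in Set.Ioc t₀ t₁, wl1 w (v t)) := by
    intro R hR
    refine (shell_energy_le hν ht.le hODE hC1 (latticeShell d r R)).trans ?_
    rw [hB, add_assoc]
    gcongr
    · rw [massOn]
      refine le_trans (le_of_eq (Finset.sum_congr rfl fun k hk => ?_)) (ENNReal.sum_le_tsum _)
      exact (if_pos (mem_latticeShell.1 hk).1).symm
    · have hpt : ∀ᵐ t ∂volume.restrict (Set.Ioc t₀ t₁),
          ENNReal.ofReal (4 * π * ∑ k ∈ latticeShell d r R,
            (starRingEnd ℂ (a t k) * ∑' j, zdot k (v t (k - j)) * a t j).im)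
          ≤ ENNReal.ofReal (4 * π * r) * (wl1 w (v t) * convMass w (a t) r) +
            ENNReal.ofReal R⁻¹ * (ENNReal.ofReal (4 * π) * ENNReal.ofReal M) * wl1 w (v t) := by
        filter_upwards [hfin, ae_restrict_mem measurableSet_Ioc] with t hvt htI
        have htI' := hIoc htI
        have hflux := ofReal_sum_transfer_le hw (hdiv t htI') (hreal t htI') hvt
          (hM t ⟨ht₀.trans htI'.1, htI'.2⟩) hr hR
        rw [ENNReal.ofReal_mul (by positivity), ENNReal.ofReal_mul (q := r) (by positivity)]
        refine (mul_le_mul_right hflux _).trans (le_of_eq ?_)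
        ring
      refine (lintegral_mono_ae hpt).trans (le_of_eq ?_)
      rw [lintegral_add_right _ (hvmeas.const_mul _), lintegral_const_mul' _ _ ofReal_ne_top,
        lintegral_const_mul _ hvmeas, mul_assoc (ENNReal.ofReal R⁻¹)]
  have hmeas : ∀ k : Fin d → ℤ, AEMeasurable (fun t => if r ≤ znorm k then
      ENNReal.ofReal (znorm k ^ 2) * (‖a t k‖₊ : ℝ≥0∞) ^ 2 else 0)
      (volume.restrict (Set.Ioc t₀ t₁)) := by
    intro k
    split_ifs
    · have := ((hcont k).mono hIoc).aemeasurable (μ := volume) measurableSet_Ioc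
      exact (this.enorm.pow_const 2).const_mul _
    · exact aemeasurable_const
  rw [lintegral_tsum hmeas, massOn, ← ENNReal.tsum_mul_left, ← ENNReal.tsum_add]
  refine ENNReal.summable.tsum_le_of_sum_le fun S => ?_
  refine ge_of_tendsto (x := Filter.atTop) (f := fun n : ℕ => B + ENNReal.ofReal (n : ℝ)⁻¹ *
    (ENNReal.ofReal (4 * π) * ENNReal.ofReal M * ∫⁻ t in Set.Ioc t₀ t₁, wl1 w (v t))) ?_ ?_
  · have h0 : Filter.Tendsto (fun n : ℕ => ENNReal.ofReal (n : ℝ)⁻¹) Filter.atTop (nhds 0) := by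
      simpa using ENNReal.tendsto_ofReal (tendsto_inv_atTop_nhds_zero_nat (𝕜 := ℝ))
    have hK : ENNReal.ofReal (4 * π) * ENNReal.ofReal M *
        ∫⁻ t in Set.Ioc t₀ t₁, wl1 w (v t) ≠ ⊤ :=
      ENNReal.mul_ne_top (ENNReal.mul_ne_top ofReal_ne_top ofReal_ne_top) hV
    simpa using (ENNReal.Tendsto.mul_const h0 (Or.inr hK)).const_add B
  · obtain ⟨n₀, hn₀⟩ : ∃ n₀ : ℕ, ∀ k ∈ S, znorm k ≤ n₀ :=
      ⟨⌈∑ k ∈ S, znorm k⌉₊, fun k hk =>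
        (Finset.single_le_sum (fun j _ => znorm_nonneg j) hk).trans (Nat.le_ceil _)⟩
    filter_upwards [Filter.eventually_ge_atTop n₀, Filter.eventually_gt_atTop 0] with n hn hn0
    refine le_trans ?_ (hshell n (by exact_mod_cast hn0))
    rw [← Finset.sum_filter_of_ne (p := fun k : Fin d → ℤ => r ≤ znorm k)]
    · refine le_trans (le_of_eq (Finset.sum_congr rfl fun k hk => ?_))
        (Finset.sum_le_sum_of_subset fun k hk => ?_)
      · simp [(Finset.mem_filter.1 hk).2]
      · obtain ⟨hkS, hkr⟩ := Finset.mem_filter.1 hk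
        exact mem_latticeShell.2 ⟨hkr, (hn₀ k hkS).trans (by exact_mod_cast hn)⟩
    · intro k _ hne
      by_contra hkr
      simp [hkr] at hne
end
end

section
/- There is an absolute constant C such that the following holds. Let m be a Borel measure on [1,∞) and K ≥ 1 with m([1,a]) ≤ K log a for all a ≥ 2. Let q ≥ 2 and set w_q(s) := 2(1+s)^q. Then for all h ≥ 1, β > 0, N₀ ≥ 1, and R ≥ max(2h, N₀², 4): μ_{N₀,R}( { r ∈ [h, R] : m([r, r+h]) ≤ β h / (16 r) } ) ≤ C^q K h^{2−q} β^{−1} + C · μ_{N₀,2R}( { s ∈ [1,∞) : (w_q^{−1} * m)(s) ≤ β / s } ). -/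
open MeasureTheory ENNReal Real Set
open scoped Classical

noncomputable section

/-- The total mass of half the Cauchy kernel. -/
theorem lintegral_half_cauchy (z : ℝ) :
    ∫⁻ s : ℝ, ENNReal.ofReal (2 * (1 + (s - z) ^ 2))⁻¹ = ENNReal.ofReal (π / 2) := by
  have h0 : ∫⁻ s : ℝ, ENNReal.ofReal (2 * (1 + (s - z) ^ 2))⁻¹
      = ∫⁻ s : ℝ, ENNReal.ofReal (2 * (1 + s ^ 2))⁻¹ :=
    lintegral_sub_right_eq_self (fun s : ℝ => ENNReal.ofReal (2 * (1 + s ^ 2))⁻¹) z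
  rw [h0, ← ofReal_integral_eq_lintegral_ofReal]
  · congr 1
    simp_rw [mul_inv]
    rw [integral_const_mul, integral_univ_inv_one_add_sq]
    ring
  · simp_rw [mul_inv]
    exact integrable_inv_one_add_sq.const_mul _
  · exact Filter.Eventually.of_forall fun s => by positivity

theorem log_two_pow_mul_le {y : ℝ} (hy : 2 ≤ y) (j : ℕ) :
    Real.log (2 ^ j * y) ≤ 2 ^ j * Real.log y := by
  rw [Real.log_mul (by positivity) (by positivity), Real.log_pow]
  have h2 : Real.log 2 ≤ Real.log y := Real.log_le_log (by norm_num) hy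
  have hj : (j : ℝ) + 1 ≤ 2 ^ j := by exact_mod_cast Nat.lt_two_pow_self
  have hl : 0 ≤ Real.log y := Real.log_nonneg (by linarith)
  nlinarith [mul_le_mul_of_nonneg_left h2 (Nat.cast_nonneg (α := ℝ) j)]

/-- A measure with logarithmically bounded growth has summable inverse square tails. -/
theorem lintegral_Ioi_inv_sq_le {m : Measure ℝ} {K : ℝ} (hK : 0 ≤ K)
    (hm : ∀ a : ℝ, 2 ≤ a → m (Set.Icc 1 a) ≤ ENNReal.ofReal (K * Real.log a))
    {A : ℝ} (hA : 1 ≤ A) :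
    ∫⁻ z in Set.Ioi A, ENNReal.ofReal (z ^ 2)⁻¹ ∂m
      ≤ ENNReal.ofReal (2 * (A ^ 2)⁻¹ * (K * Real.log (2 * A))) := by
  have hl : 0 ≤ Real.log (2 * A) := Real.log_nonneg (by linarith)
  have hcov : Set.Ioi A ⊆ ⋃ j : ℕ, Set.Icc (2 ^ j * A) (2 ^ (j + 1) * A) := by
    intro z hz
    have hz' : A < z := hz
    obtain ⟨n, h1, h2⟩ := exists_nat_pow_near (x := z / A) (y := 2)
      ((one_le_div (by linarith)).2 hz'.le) (by norm_num)
    rw [le_div_iff₀ (by linarith)] at h1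
    rw [div_lt_iff₀ (by linarith)] at h2
    exact Set.mem_iUnion.2 ⟨n, h1, h2.le⟩
  calc ∫⁻ z in Set.Ioi A, ENNReal.ofReal (z ^ 2)⁻¹ ∂m
      ≤ ∫⁻ z in ⋃ j : ℕ, Set.Icc (2 ^ j * A) (2 ^ (j + 1) * A), ENNReal.ofReal (z ^ 2)⁻¹ ∂m :=
        lintegral_mono_set hcov
    _ ≤ ∑' j : ℕ, ∫⁻ z in Set.Icc (2 ^ j * A) (2 ^ (j + 1) * A), ENNReal.ofReal (z ^ 2)⁻¹ ∂m :=
        lintegral_iUnion_le _ _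
    _ ≤ ∑' j : ℕ, ENNReal.ofReal ((A ^ 2)⁻¹ * (K * Real.log (2 * A)) * (1 / 2) ^ j) := by
        refine ENNReal.tsum_le_tsum fun j => ?_
        have h2j : (1 : ℝ) ≤ 2 ^ j := one_le_pow₀ (by norm_num)
        have hmass : m (Set.Icc (2 ^ j * A) (2 ^ (j + 1) * A))
            ≤ ENNReal.ofReal (K * (2 ^ j * Real.log (2 * A))) := by
          refine (measure_mono (t := Set.Icc 1 (2 ^ (j + 1) * A)) ?_).trans ((hm _ ?_).trans ?_)
          · exact fun z hz => ⟨by nlinarith [hz.1], hz.2⟩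
          · rw [pow_succ]; nlinarith
          · refine ENNReal.ofReal_le_ofReal (mul_le_mul_of_nonneg_left ?_ hK)
            have := log_two_pow_mul_le (y := 2 * A) (by linarith) j
            rwa [pow_succ, mul_assoc]
        calc ∫⁻ z in Set.Icc (2 ^ j * A) (2 ^ (j + 1) * A), ENNReal.ofReal (z ^ 2)⁻¹ ∂m
            ≤ ∫⁻ _ in Set.Icc (2 ^ j * A) (2 ^ (j + 1) * A),
                ENNReal.ofReal ((2 ^ j * A) ^ 2)⁻¹ ∂m := by
              refine setLIntegral_mono measurable_const fun z hz => ENNReal.ofReal_le_ofReal ?_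
              have := hz.1
              gcongr
          _ = ENNReal.ofReal ((2 ^ j * A) ^ 2)⁻¹ * m (Set.Icc (2 ^ j * A) (2 ^ (j + 1) * A)) := by
              rw [setLIntegral_const]
          _ ≤ ENNReal.ofReal ((2 ^ j * A) ^ 2)⁻¹
                * ENNReal.ofReal (K * (2 ^ j * Real.log (2 * A))) := by gcongr
          _ = _ := by
              rw [← ENNReal.ofReal_mul (by positivity)]
              congr 1
              rw [one_div, inv_pow]
              field_simp
    _ = _ := by
        have hs : Summable fun j : ℕ =>
            (A ^ 2)⁻¹ * (K * Real.log (2 * A)) * (1 / 2 : ℝ) ^ j :=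
          summable_geometric_two.mul_left _
        rw [← ENNReal.ofReal_tsum_of_nonneg (fun j => by positivity) hs, tsum_mul_left,
          tsum_geometric_two]
        congr 1
        ring

/-- The Cauchy convolution of a measure with logarithmically bounded growth has at most
logarithmic mass on `[0, 2R]`. -/
theorem lintegral_cauchy_convolution_le {m : Measure ℝ} [SFinite m] {K : ℝ} (hK : 0 ≤ K)
    (hm0 : m (Set.Iio 1) = 0)
    (hm : ∀ a : ℝ, 2 ≤ a → m (Set.Icc 1 a) ≤ ENNReal.ofReal (K * Real.log a))
    {R : ℝ} (hR : 1 ≤ R) :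
    ∫⁻ s in Set.Icc 0 (2 * R), ∫⁻ z, ENNReal.ofReal (2 * (1 + (s - z) ^ 2))⁻¹ ∂m
      ≤ ENNReal.ofReal (3 * (K * Real.log (8 * R))) := by
  have hl : 0 ≤ Real.log (8 * R) := Real.log_nonneg (by linarith)
  rw [lintegral_lintegral_swap (by fun_prop)]
  have hsplit : ∀ f : ℝ → ℝ≥0∞, ∫⁻ z, f z ∂m
      ≤ ∫⁻ z in Set.Icc 1 (4 * R), f z ∂m + ∫⁻ z in Set.Ioi (4 * R), f z ∂m := by
    intro f
    rw [← setLIntegral_univ f]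
    have hu : (Set.univ : Set ℝ) ⊆ Set.Iio 1 ∪ (Set.Icc 1 (4 * R) ∪ Set.Ioi (4 * R)) := by
      intro z _
      by_cases h1 : z < 1
      · exact Or.inl h1
      · by_cases h2 : z ≤ 4 * R
        · exact Or.inr (Or.inl ⟨not_lt.1 h1, h2⟩)
        · exact Or.inr (Or.inr (not_le.1 h2))
    refine (lintegral_mono_set hu).trans ((lintegral_union_le _ _ _).trans ?_)
    rw [setLIntegral_measure_zero _ _ hm0, zero_add]
    exact lintegral_union_le _ _ _
  refine (hsplit _).trans ?_
  have hnear : ∫⁻ z in Set.Icc 1 (4 * R), (∫⁻ s in Set.Icc 0 (2 * R),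
      ENNReal.ofReal (2 * (1 + (s - z) ^ 2))⁻¹) ∂m
      ≤ ENNReal.ofReal (2 * (K * Real.log (8 * R))) := by
    calc _ ≤ ∫⁻ _ in Set.Icc 1 (4 * R), ENNReal.ofReal 2 ∂m := by
          refine setLIntegral_mono measurable_const fun z _ => ?_
          refine (setLIntegral_le_lintegral _ _).trans ?_
          rw [lintegral_half_cauchy]
          exact ENNReal.ofReal_le_ofReal (by linarith [Real.pi_le_four])
      _ ≤ ENNReal.ofReal 2 * ENNReal.ofReal (K * Real.log (8 * R)) := by
          rw [setLIntegral_const]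
          gcongr
          refine (hm _ (by linarith)).trans (ENNReal.ofReal_le_ofReal ?_)
          gcongr
          norm_num
      _ = _ := (ENNReal.ofReal_mul (by norm_num)).symm
  have hfar : ∫⁻ z in Set.Ioi (4 * R), (∫⁻ s in Set.Icc 0 (2 * R),
      ENNReal.ofReal (2 * (1 + (s - z) ^ 2))⁻¹) ∂m
      ≤ ENNReal.ofReal (K * Real.log (8 * R)) := by
    calc _ ≤ ∫⁻ z in Set.Ioi (4 * R), ENNReal.ofReal (4 * R) * ENNReal.ofReal (z ^ 2)⁻¹ ∂m := by
          refine setLIntegral_mono (by fun_prop) fun z hz => ?_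
          have hz' : 4 * R < z := hz
          calc _ ≤ ∫⁻ _ in Set.Icc 0 (2 * R), ENNReal.ofReal (2 * (z ^ 2)⁻¹) := by
                refine setLIntegral_mono measurable_const fun s hs => ENNReal.ofReal_le_ofReal ?_
                have hzs : z / 2 ≤ z - s := by linarith [hs.2]
                have hsq : (z / 2) ^ 2 ≤ (s - z) ^ 2 := by nlinarith
                have hz0 : 0 < z := by linarith
                rw [← div_eq_mul_inv, inv_le_comm₀ (by positivity) (by positivity), inv_div]
                linarith
            _ = _ := by
                rw [setLIntegral_const, Real.volume_Icc, ← ENNReal.ofReal_mul (by positivity),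
                  ← ENNReal.ofReal_mul (by positivity)]
                congr 1
                ring
      _ = ENNReal.ofReal (4 * R) * ∫⁻ z in Set.Ioi (4 * R), ENNReal.ofReal (z ^ 2)⁻¹ ∂m :=
          lintegral_const_mul _ (by fun_prop)
      _ ≤ ENNReal.ofReal (4 * R) *
            ENNReal.ofReal (2 * ((4 * R) ^ 2)⁻¹ * (K * Real.log (2 * (4 * R)))) := by
          gcongr
          exact lintegral_Ioi_inv_sq_le hK hm (by linarith)
      _ ≤ _ := by
          rw [← ENNReal.ofReal_mul (by positivity), show 2 * (4 * R) = 8 * R by ring]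
          refine ENNReal.ofReal_le_ofReal ?_
          have h1 : 4 * R * (2 * ((4 * R) ^ 2)⁻¹ * (K * Real.log (8 * R)))
              = (1 / (2 * R)) * (K * Real.log (8 * R)) := by field_simp; ring
          rw [h1]
          refine mul_le_of_le_one_left (by positivity) ?_
          rw [div_le_one (by positivity)]
          linarith
  refine (add_le_add hnear hfar).trans_eq ?_
  rw [← ENNReal.ofReal_add (by positivity) (by positivity)]
  congr 1
  ring

theorem inv_polynomial_weight_le_cauchy {q : ℝ} (hq : 2 ≤ q) (x : ℝ) :
    (ENNReal.ofReal (2 * (1 + |x|) ^ q))⁻¹ ≤ ENNReal.ofReal (2 * (1 + x ^ 2))⁻¹ := by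
  have h1 : (1 : ℝ) ≤ 1 + |x| := by linarith [abs_nonneg x]
  rw [← ENNReal.ofReal_inv_of_pos (by positivity)]
  refine ENNReal.ofReal_le_ofReal ?_
  gcongr
  calc 1 + x ^ 2 ≤ (1 + |x|) ^ (2 : ℝ) := by
        rw [Real.rpow_two, ← sq_abs]; nlinarith [abs_nonneg x]
    _ ≤ _ := Real.rpow_le_rpow_of_exponent_le h1 hq

theorem inv_polynomial_weight_le_cauchy_of_far {q h : ℝ} (hq : 2 ≤ q) (hh : 0 < h) {x : ℝ}
    (hx : h / 4 ≤ |x|) :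
    (ENNReal.ofReal (2 * (1 + |x|) ^ q))⁻¹
      ≤ ENNReal.ofReal (4 ^ q * h ^ (2 - q)) * ENNReal.ofReal (2 * (1 + x ^ 2))⁻¹ := by
  have h1 : (0 : ℝ) < 1 + |x| := by linarith [abs_nonneg x]
  rw [← ENNReal.ofReal_inv_of_pos (by positivity), ← ENNReal.ofReal_mul (by positivity)]
  refine ENNReal.ofReal_le_ofReal ?_
  have h2 : (1 + |x|) ^ (2 - q) ≤ 4 ^ q * h ^ (2 - q) := by
    calc (1 + |x|) ^ (2 - q) ≤ (h / 4) ^ (2 - q) :=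
          Real.rpow_le_rpow_of_nonpos (by positivity) (by linarith) (by linarith)
      _ = 4 ^ (q - 2) * h ^ (2 - q) := by
          rw [Real.div_rpow hh.le (by norm_num), div_eq_mul_inv, ← Real.rpow_neg (by norm_num),
            neg_sub, mul_comm]
      _ ≤ _ := by
          gcongr
          · norm_num
          · linarith
  have h3 : ((1 + |x|) ^ q)⁻¹ = (1 + |x|) ^ (2 - q) * ((1 + |x|) ^ 2)⁻¹ := by
    rw [← Real.rpow_two, ← Real.rpow_neg h1.le, ← Real.rpow_neg h1.le, ← Real.rpow_add h1]
    congr 1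
    ring
  rw [mul_inv, mul_inv, h3]
  have h4 : ((1 + |x|) ^ 2)⁻¹ ≤ (1 + x ^ 2)⁻¹ := by
    gcongr
    rw [← sq_abs]; nlinarith [abs_nonneg x]
  have h5 := mul_le_mul h2 h4 (by positivity) (by positivity)
  linarith

/-- If the mass of `[r, r + h]` is small, then the convolved mass density is small, or the tail
contribution is large, on a fixed proportion of `[r, r + h]`. -/
theorem le_volume_inter_of_undercharged {m : Measure ℝ} [SFinite m] {q h r β : ℝ} (hq : 2 ≤ q)
    (hh : 0 < h) (hr : h ≤ r) (hβ : 0 < β)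
    (hu : m (Set.Icc r (r + h)) ≤ ENNReal.ofReal (β * h / (16 * r))) {B : Set ℝ}
    (hB : MeasurableSet B)
    (hlow : ∀ s ∈ Set.Icc r (r + h), s ∉ B →
      ENNReal.ofReal (β / s) < ∫⁻ z, (ENNReal.ofReal (2 * (1 + |s - z|) ^ q))⁻¹ ∂m)
    (htail : ∀ s ∈ Set.Icc r (r + h), s ∉ B →
      ENNReal.ofReal (4 ^ q * h ^ (2 - q)) * ∫⁻ z, ENNReal.ofReal (2 * (1 + (s - z) ^ 2))⁻¹ ∂m
        ≤ ENNReal.ofReal (β / (2 * s))) :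
    ENNReal.ofReal (h / 10) ≤ volume (B ∩ Set.Icc r (r + h)) := by
  have hr0 : 0 < r := hh.trans_le hr
  set G : Set ℝ := Set.Icc (r + h / 4) (r + 3 * h / 4) with hG
  have hGsub : G ⊆ Set.Icc r (r + h) := Set.Icc_subset_Icc (by linarith) (by linarith)
  have hnear : ∀ s ∈ G \ B, ENNReal.ofReal (β / (4 * r))
      ≤ ∫⁻ z in Set.Icc r (r + h), ENNReal.ofReal (2 * (1 + (s - z) ^ 2))⁻¹ ∂m := by
    rintro s ⟨hsG, hsB⟩
    have hs := hGsub hsG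
    have hs0 : 0 < s := hr0.trans_le hs.1
    by_contra! hlt
    refine (hlow s hs hsB).not_ge ?_
    rw [← lintegral_add_compl _ (measurableSet_Icc (a := r) (b := r + h))]
    have h1 : ∫⁻ z in Set.Icc r (r + h), (ENNReal.ofReal (2 * (1 + |s - z|) ^ q))⁻¹ ∂m
        ≤ ENNReal.ofReal (β / (2 * s)) := by
      refine (lintegral_mono fun z => inv_polynomial_weight_le_cauchy hq (s - z)).trans
        (hlt.le.trans (ENNReal.ofReal_le_ofReal ?_))
      refine div_le_div_of_nonneg_left hβ.le (by positivity) ?_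
      linarith [hs.2]
    have h2 : ∫⁻ z in (Set.Icc r (r + h))ᶜ, (ENNReal.ofReal (2 * (1 + |s - z|) ^ q))⁻¹ ∂m
        ≤ ENNReal.ofReal (β / (2 * s)) := by
      refine le_trans ?_ (htail s hs hsB)
      rw [← lintegral_const_mul _ (by fun_prop)]
      refine le_trans (setLIntegral_mono (by fun_prop) fun z hz => ?_)
        (setLIntegral_le_lintegral _ _)
      refine inv_polynomial_weight_le_cauchy_of_far hq hh ?_
      rw [le_abs]
      by_contra! hcon
      exact hz ⟨by linarith [hsG.1, hcon.1], by linarith [hsG.2, hcon.2]⟩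
    refine (add_le_add h1 h2).trans_eq ?_
    rw [← ENNReal.ofReal_add (by positivity) (by positivity)]
    congr 1
    field_simp
    norm_num
  have hGB : volume (G \ B) ≤ ENNReal.ofReal (2 * h / 5) := by
    have h1 : ENNReal.ofReal (β / (4 * r)) * volume (G \ B)
        ≤ ENNReal.ofReal (β / (4 * r)) * ENNReal.ofReal (2 * h / 5) := by
      calc _ = ∫⁻ _ in G \ B, ENNReal.ofReal (β / (4 * r)) := (setLIntegral_const _ _).symm
        _ ≤ ∫⁻ s in G \ B, ∫⁻ z in Set.Icc r (r + h),
              ENNReal.ofReal (2 * (1 + (s - z) ^ 2))⁻¹ ∂m :=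
            setLIntegral_mono' (measurableSet_Icc.diff hB) hnear
        _ ≤ ∫⁻ s, ∫⁻ z in Set.Icc r (r + h), ENNReal.ofReal (2 * (1 + (s - z) ^ 2))⁻¹ ∂m :=
            setLIntegral_le_lintegral _ _
        _ = ENNReal.ofReal (π / 2) * m (Set.Icc r (r + h)) := by
            rw [lintegral_lintegral_swap (by fun_prop)]
            simp_rw [lintegral_half_cauchy]
            rw [setLIntegral_const]
        _ ≤ ENNReal.ofReal (8 / 5) * ENNReal.ofReal (β * h / (16 * r)) := by
            refine mul_le_mul' (ENNReal.ofReal_le_ofReal ?_) hu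
            linarith [Real.pi_lt_d2]
        _ = _ := by
            rw [← ENNReal.ofReal_mul (by norm_num), ← ENNReal.ofReal_mul (by positivity)]
            congr 1
            field_simp
            norm_num
    exact (ENNReal.mul_le_mul_iff_right (by simp; positivity) ENNReal.ofReal_ne_top).1 h1
  have hvol : ENNReal.ofReal (h / 10) + ENNReal.ofReal (2 * h / 5) = volume G := by
    rw [← ENNReal.ofReal_add (by positivity) (by positivity), hG, Real.volume_Icc]
    congr 1
    ring
  have hsplit : volume G ≤ volume (B ∩ Set.Icc r (r + h)) + ENNReal.ofReal (2 * h / 5) := by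
    rw [← measure_inter_add_sdiff G hB, Set.inter_comm]
    gcongr
  rw [← hvol] at hsplit
  exact (ENNReal.add_le_add_iff_right ENNReal.ofReal_ne_top).1 hsplit

/-- If `B` occupies a fixed proportion of `[r, r + h]` for each `r ∈ U`, then the logarithmic
measure of `U` is controlled by that of `B`. -/
theorem lintegral_inv_le_of_le_volume_inter {h N R : ℝ} (hh : 0 < h) {U B : Set ℝ}
    (hU : ∀ r ∈ U, h ≤ r ∧ N ≤ r ∧ r + h ≤ R)
    (hUB : ∀ r ∈ U, ENNReal.ofReal (h / 10) ≤ volume (B ∩ Set.Icc r (r + h))) :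
    ∫⁻ r in U, ENNReal.ofReal r⁻¹
      ≤ ENNReal.ofReal 20 * ∫⁻ s in B ∩ Set.Icc N R, ENNReal.ofReal s⁻¹ := by
  let S : Set (ℝ × ℝ) := {p | p.1 ≤ p.2 ∧ p.2 ≤ p.1 + h}
  have hS : MeasurableSet S :=
    (measurableSet_le measurable_fst measurable_snd).inter
      (measurableSet_le measurable_snd (measurable_fst.add_const h))
  let F : ℝ × ℝ → ℝ≥0∞ := S.indicator fun p => ENNReal.ofReal (2 * p.2⁻¹)
  have hF : Measurable F := Measurable.indicator (by fun_prop) hS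
  have hmeas : Measurable fun r : ℝ => ∫⁻ s in B ∩ Set.Icc N R, F (r, s) :=
    hF.lintegral_prod_right'
  calc ∫⁻ r in U, ENNReal.ofReal r⁻¹
      ≤ ∫⁻ r in U, ENNReal.ofReal (10 / h) * ∫⁻ s in B ∩ Set.Icc N R, F (r, s) := by
        refine setLIntegral_mono (hmeas.const_mul _) fun r hrU => ?_
        obtain ⟨hhr, hNr, hrR⟩ := hU r hrU
        have hr0 : 0 < r := hh.trans_le hhr
        have hint : ENNReal.ofReal r⁻¹ * ENNReal.ofReal (h / 10)
            ≤ ∫⁻ s in B ∩ Set.Icc N R, F (r, s) := by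
          calc _ ≤ ENNReal.ofReal r⁻¹ * volume (B ∩ Set.Icc r (r + h)) := by
                gcongr
                exact hUB r hrU
            _ = ∫⁻ _ in B ∩ Set.Icc r (r + h), ENNReal.ofReal r⁻¹ :=
                (setLIntegral_const _ _).symm
            _ ≤ ∫⁻ s in B ∩ Set.Icc r (r + h), F (r, s) := by
                refine setLIntegral_mono (hF.comp measurable_prodMk_left) fun s hs => ?_
                have hsS : (r, s) ∈ S := hs.2
                simp only [F, Set.indicator_of_mem hsS]
                refine ENNReal.ofReal_le_ofReal ?_
                have hs1 := hs.2.1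
                have hs2 := hs.2.2
                have hs0 : 0 < s := by linarith
                rw [← div_eq_mul_inv, inv_le_comm₀ hr0 (by positivity), inv_div]
                linarith
            _ ≤ _ := lintegral_mono_set
                (Set.inter_subset_inter_right _ (Set.Icc_subset_Icc hNr hrR))
        calc ENNReal.ofReal r⁻¹
            = ENNReal.ofReal (10 / h) * (ENNReal.ofReal r⁻¹ * ENNReal.ofReal (h / 10)) := by
              rw [← ENNReal.ofReal_mul (by positivity), ← ENNReal.ofReal_mul (by positivity)]
              congr 1
              field_simp
          _ ≤ _ := by gcongr
    _ ≤ ∫⁻ r, ENNReal.ofReal (10 / h) * ∫⁻ s in B ∩ Set.Icc N R, F (r, s) :=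
        setLIntegral_le_lintegral _ _
    _ = ENNReal.ofReal (10 / h) * ∫⁻ s in B ∩ Set.Icc N R, ∫⁻ r, F (r, s) := by
        rw [lintegral_const_mul _ hmeas, lintegral_lintegral_swap]
        exact hF.aemeasurable
    _ = ENNReal.ofReal (10 / h) *
          ∫⁻ s in B ∩ Set.Icc N R, ENNReal.ofReal (2 * h) * ENNReal.ofReal s⁻¹ := by
        congr 1
        refine lintegral_congr fun s => ?_
        have h1 : (fun r => F (r, s))
            = (Set.Icc (s - h) s).indicator fun _ => ENNReal.ofReal (2 * s⁻¹) := by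
          ext r
          simp only [F, S, Set.indicator_apply, Set.mem_ofPred_eq, Set.mem_Icc]
          congr 1
          rw [sub_le_iff_le_add, and_comm]
        rw [h1, lintegral_indicator_const measurableSet_Icc, Real.volume_Icc,
          ENNReal.ofReal_mul (by norm_num), ENNReal.ofReal_mul (by norm_num), _root_.sub_sub_cancel]
        ring
    _ = _ := by
        rw [lintegral_const_mul _ (by fun_prop), ← mul_assoc, ← ENNReal.ofReal_mul (by positivity)]
        congr 2
        field_simp
        norm_num

theorem sFinite_of_measure_Icc_lt_top {m : Measure ℝ} (hm0 : m (Set.Iio 1) = 0)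
    (hm : ∀ a : ℝ, 2 ≤ a → m (Set.Icc 1 a) < ∞) : SFinite m := by
  have hfin : ∀ n : ℕ, m (Set.Iic ((n : ℝ) + 2)) < ∞ := fun n => by
    have hsub : Set.Iic ((n : ℝ) + 2) ⊆ Set.Iio 1 ∪ Set.Icc 1 ((n : ℝ) + 2) := fun z hz =>
      (lt_or_ge z 1).imp id fun h1 => ⟨h1, hz⟩
    refine (measure_mono hsub).trans_lt ((measure_union_le _ _).trans_lt ?_)
    rw [hm0, zero_add]
    exact hm _ (by linarith [Nat.cast_nonneg (α := ℝ) n])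
  have : SigmaFinite m := ⟨⟨{
    set := fun n => Set.Iic ((n : ℝ) + 2)
    set_mem := fun _ => trivial
    finite := hfin
    spanning := by
      refine Set.eq_univ_of_forall fun z => Set.mem_iUnion.2 ?_
      obtain ⟨n, hn⟩ := exists_nat_ge z
      exact ⟨n, hn.trans (by linarith)⟩ }⟩⟩
  infer_instance

/-- radii whose annulus `[r,r+h]` is undercharged either are rare in
logarithmic density, or have an undercharged convolved mass density `w_q⁻¹ * m`. -/
theorem undercharged_annuli_from_convolution :
    ∃ C : ℝ, 0 < C ∧
      ∀ (m : Measure ℝ) (K : ℝ), 1 ≤ K → m (Set.Iio 1) = 0 →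
      (∀ a : ℝ, 2 ≤ a → m (Set.Icc 1 a) ≤ ENNReal.ofReal (K * Real.log a)) →
      ∀ q h β N₀ R : ℝ, 2 ≤ q → 1 ≤ h → 0 < β → 1 ≤ N₀ →
        2 * h ≤ R → N₀ ^ 2 ≤ R → 4 ≤ R →
        logDensity N₀ R {r : ℝ | h ≤ r ∧ r ≤ R ∧
            m (Set.Icc r (r + h)) ≤ ENNReal.ofReal (β * h / (16 * r))}
          ≤ ENNReal.ofReal (C ^ q * K * h ^ (2 - q) / β)
            + ENNReal.ofReal C *
              logDensity N₀ (2 * R) {s : ℝ | 1 ≤ s ∧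
                (∫⁻ z in Set.Ici (1 : ℝ), (ENNReal.ofReal (2 * (1 + |s - z|) ^ q))⁻¹ ∂m)
                  ≤ ENNReal.ofReal (β / s)} := by
  refine ⟨100, by norm_num, fun m K hK hm0 hm q h β N₀ R hq hh hβ hN hhR hNR hR => ?_⟩
  have hK0 : 0 ≤ K := by linarith
  have hh0 : 0 < h := by linarith
  have hN0 : 0 < N₀ := by linarith
  have hR0 : 0 < R := by linarith
  have : SFinite m :=
    sFinite_of_measure_Icc_lt_top hm0 fun a ha => (hm a ha).trans_lt ENNReal.ofReal_lt_top
  have hrestr : m.restrict (Set.Ici 1) = m := by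
    refine Measure.restrict_eq_self_of_ae_mem ?_
    rw [ae_iff]
    convert hm0 using 2
    ext z
    simp
  rw [hrestr]
  set U : Set ℝ := {r : ℝ | h ≤ r ∧ r ≤ R ∧
    m (Set.Icc r (r + h)) ≤ ENNReal.ofReal (β * h / (16 * r))}
  let W : ℝ → ℝ≥0∞ := fun s => ∫⁻ z, (ENNReal.ofReal (2 * (1 + |s - z|) ^ q))⁻¹ ∂m
  let P : ℝ → ℝ≥0∞ := fun s => ∫⁻ z, ENNReal.ofReal (2 * (1 + (s - z) ^ 2))⁻¹ ∂m
  have hW : Measurable W := by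
    refine Measurable.lintegral_prod_right'
      (f := fun p : ℝ × ℝ => (ENNReal.ofReal (2 * (1 + |p.1 - p.2|) ^ q))⁻¹) ?_
    fun_prop
  have hP : Measurable P := by
    refine Measurable.lintegral_prod_right'
      (f := fun p : ℝ × ℝ => ENNReal.ofReal (2 * (1 + (p.1 - p.2) ^ 2))⁻¹) ?_
    fun_prop
  set V : Set ℝ := {s : ℝ | 1 ≤ s ∧ W s ≤ ENNReal.ofReal (β / s)}
  set D : ℝ := 4 ^ q * h ^ (2 - q) with hD
  have hD0 : 0 < D := by positivity
  let X : Set ℝ := {s : ℝ | ENNReal.ofReal (β / (2 * s)) < ENNReal.ofReal D * P s}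
  have hV : MeasurableSet V :=
    measurableSet_Ici.inter (measurableSet_le hW (by fun_prop))
  have hX : MeasurableSet X :=
    measurableSet_lt (by fun_prop) (hP.const_mul _)
  have hUB : ∫⁻ r in U ∩ Set.Icc N₀ R, ENNReal.ofReal r⁻¹
      ≤ ENNReal.ofReal 20 *
        ∫⁻ s in (V ∪ X) ∩ Set.Icc N₀ (2 * R), ENNReal.ofReal s⁻¹ := by
    refine lintegral_inv_le_of_le_volume_inter hh0
      (fun r hr => ⟨hr.1.1, hr.2.1, by linarith [hr.2.2]⟩) fun r hr => ?_
    refine le_volume_inter_of_undercharged hq hh0 hr.1.1 hβ hr.1.2.2 (hV.union hX) ?_ ?_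
    · intro s hs hsB
      by_contra! hcon
      exact hsB (Or.inl ⟨by linarith [hs.1, hr.2.1], hcon⟩)
    · intro s _ hsB
      by_contra! hcon
      exact hsB (Or.inr hcon)
  have hXint : ∫⁻ s in X ∩ Set.Icc N₀ (2 * R), ENNReal.ofReal s⁻¹
      ≤ ENNReal.ofReal (2 * D / β * (3 * (K * Real.log (8 * R)))) := by
    calc _ ≤ ∫⁻ s in X ∩ Set.Icc N₀ (2 * R), ENNReal.ofReal (2 * D / β) * P s := by
          refine setLIntegral_mono (hP.const_mul _) fun s hs => ?_
          have hs0 : 0 < s := hN0.trans_le hs.2.1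
          have hsX : ENNReal.ofReal (β / (2 * s)) < ENNReal.ofReal D * P s := hs.1
          calc ENNReal.ofReal s⁻¹
              = ENNReal.ofReal (2 / β) * ENNReal.ofReal (β / (2 * s)) := by
                rw [← ENNReal.ofReal_mul (by positivity)]
                congr 1
                field_simp
            _ ≤ ENNReal.ofReal (2 / β) * (ENNReal.ofReal D * P s) := by gcongr
            _ = _ := by
                rw [← mul_assoc, ← ENNReal.ofReal_mul (by positivity)]
                congr 2
                ring
      _ ≤ ∫⁻ s in Set.Icc 0 (2 * R), ENNReal.ofReal (2 * D / β) * P s :=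
          lintegral_mono_set
            (Set.inter_subset_right.trans (Set.Icc_subset_Icc_left hN0.le))
      _ = ENNReal.ofReal (2 * D / β) * ∫⁻ s in Set.Icc 0 (2 * R), P s :=
          lintegral_const_mul _ hP
      _ ≤ ENNReal.ofReal (2 * D / β) * ENNReal.ofReal (3 * (K * Real.log (8 * R))) := by
          gcongr
          exact lintegral_cauchy_convolution_le hK0 hm0 hm (by linarith)
      _ = _ := (ENNReal.ofReal_mul (by positivity)).symm
  have hlogR : 0 < Real.log R := Real.log_pos (by linarith)
  have hlogN : 2 * Real.log N₀ ≤ Real.log R := by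
    have := Real.log_le_log (by positivity) hNR
    rwa [Real.log_pow] at this
  have hL : Real.log (R / N₀) = Real.log R - Real.log N₀ := Real.log_div hR0.ne' hN0.ne'
  have hL0 : 0 < Real.log (R / N₀) := by linarith
  have hlog2 : 2 * Real.log 2 ≤ Real.log R := by
    have := Real.log_le_log (by norm_num) hR
    rwa [show (4 : ℝ) = 2 ^ 2 by norm_num, Real.log_pow] at this
  have hL2 : Real.log (2 * R / N₀) ≤ 2 * Real.log (R / N₀) := by
    rw [mul_div_assoc, Real.log_mul (by norm_num) (by positivity)]
    linarith
  have hL20 : 0 < Real.log (2 * R / N₀) := by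
    rw [mul_div_assoc, Real.log_mul (by norm_num) (by positivity)]
    linarith [Real.log_pos (by norm_num : (1 : ℝ) < 2)]
  have hL8 : Real.log (8 * R) ≤ 5 * Real.log (R / N₀) := by
    rw [Real.log_mul (by norm_num) hR0.ne', show (8 : ℝ) = 2 ^ 3 by norm_num, Real.log_pow]
    push_cast
    linarith
  have hconst : 20 * (2 * D / β * (3 * (K * Real.log (8 * R)))) / Real.log (R / N₀)
      ≤ 100 ^ q * K * h ^ (2 - q) / β := by
    rw [div_le_iff₀ hL0]
    have h25 : (600 : ℝ) ≤ 25 ^ q := by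
      calc (600 : ℝ) ≤ 25 ^ (2 : ℝ) := by norm_num
        _ ≤ _ := Real.rpow_le_rpow_of_exponent_le (by norm_num) hq
    calc 20 * (2 * D / β * (3 * (K * Real.log (8 * R))))
        ≤ 20 * (2 * D / β * (3 * (K * (5 * Real.log (R / N₀))))) := by gcongr
      _ = 600 * (D * K / β * Real.log (R / N₀)) := by ring
      _ ≤ 25 ^ q * (D * K / β * Real.log (R / N₀)) := by gcongr
      _ = _ := by
          rw [hD, show (100 : ℝ) = 25 * 4 by norm_num,
            Real.mul_rpow (by norm_num) (by norm_num)]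
          ring
  have hinv : ENNReal.ofReal 20 * (ENNReal.ofReal (Real.log (R / N₀)))⁻¹
      ≤ ENNReal.ofReal 100 * (ENNReal.ofReal (Real.log (2 * R / N₀)))⁻¹ := by
    rw [← ENNReal.ofReal_inv_of_pos hL0, ← ENNReal.ofReal_inv_of_pos hL20,
      ← ENNReal.ofReal_mul (by norm_num), ← ENNReal.ofReal_mul (by norm_num)]
    refine ENNReal.ofReal_le_ofReal ?_
    rw [← div_eq_mul_inv, ← div_eq_mul_inv, div_le_div_iff₀ hL0 hL20]
    linarith
  unfold logDensity
  calc _ ≤ (ENNReal.ofReal (Real.log (R / N₀)))⁻¹ * (ENNReal.ofReal 20 *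
        ((∫⁻ s in V ∩ Set.Icc N₀ (2 * R), ENNReal.ofReal s⁻¹)
          + ENNReal.ofReal (2 * D / β * (3 * (K * Real.log (8 * R)))))) := by
        gcongr
        refine hUB.trans ?_
        refine mul_le_mul_right ?_ _
        rw [Set.union_inter_distrib_right]
        exact (lintegral_union_le _ _ _).trans (by gcongr)
    _ = (ENNReal.ofReal (Real.log (R / N₀)))⁻¹ * (ENNReal.ofReal 20 *
          ENNReal.ofReal (2 * D / β * (3 * (K * Real.log (8 * R)))))
        + (ENNReal.ofReal 20 * (ENNReal.ofReal (Real.log (R / N₀)))⁻¹) *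
          ∫⁻ s in V ∩ Set.Icc N₀ (2 * R), ENNReal.ofReal s⁻¹ := by ring
    _ ≤ _ := by
        refine add_le_add ?_ ?_
        · rw [← ENNReal.ofReal_inv_of_pos hL0, ← ENNReal.ofReal_mul (by norm_num),
            ← ENNReal.ofReal_mul (by positivity), mul_comm, ← div_eq_mul_inv]
          exact ENNReal.ofReal_le_ofReal hconst
        · rw [← mul_assoc]
          gcongr
end
end
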